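/- The derivability problem for !L1 is undecidable: the predicate 'the sequent Π → A is derivable in !L1', on the (countable, effectively encodable) set of !L1-sequents, is not a computable (decidable) predicate. -/

import Mathlib

namespace Lambek

/-! ## Formulae of `!bL1` (Lambek calculus with unit, brackets and subexponential) -/

/-- Formulae: primitive types, the unit `1`, `\`, `/`, `·`, `⟨⟩`, `[]⁻¹`, `!`. -/
inductive Fm : Type
  | var : ℕ → Fm
  | one : Fm
  | ldiv : Fm → Fm → Fm   -- `ldiv A C` is `A \ C`
  | rdiv : Fm → Fm → Fm   -- `rdiv C B` is `C / B`
  | mul : Fm → Fm → Fm    -- `A · B`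
  | dia : Fm → Fm         -- `⟨⟩ A`
  | binv : Fm → Fm        -- `[]⁻¹ A`
  | bang : Fm → Fm        -- `! A`

/-- Items of a meta-formula: a formula or a bracketed meta-formula. -/
inductive Item : Type
  | fm : Fm → Item
  | br : List Item → Item

/-- Meta-formulae (configurations): finite ordered sequences of items. -/
abbrev Meta := List Item

/-- `!A₁, …, !Aₙ` as a meta-formula. -/
def bangs (Φ : List Fm) : Meta := Φ.map (fun F => Item.fm (Fm.bang F))

/-- A meta-formula with a designated (hole) occurrence of a meta-formula,
possibly under nested brackets. -/
inductive Ctx : Type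
  | hole : Meta → Meta → Ctx
  | br : Meta → Ctx → Meta → Ctx

/-- Plug a meta-formula into the designated occurrence. -/
def Ctx.fill : Ctx → Meta → Meta
  | Ctx.hole Δ₁ Δ₂, Γ => Δ₁ ++ Γ ++ Δ₂
  | Ctx.br Δ₁ c Δ₂, Γ => Δ₁ ++ (Item.br (c.fill Γ)) :: Δ₂

/-- Derivability in `!bL1`.  The boolean parameter says whether the rule (cut)
is allowed: `DervB true` is full `!bL1`, `DervB false` is cut-free derivability. -/
inductive DervB : Bool → Meta → Fm → Prop
  | id (cf : Bool) (A : Fm) : DervB cf [Item.fm A] A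
  | one_r (cf : Bool) : DervB cf [] Fm.one
  | rdiv_l (cf : Bool) (Δ : Ctx) (Γ : Meta) (B C D : Fm) :
      DervB cf Γ B → DervB cf (Δ.fill [Item.fm C]) D →
      DervB cf (Δ.fill (Item.fm (Fm.rdiv C B) :: Γ)) D
  | rdiv_r (cf : Bool) (Γ : Meta) (B C : Fm) :
      DervB cf (Γ ++ [Item.fm B]) C → DervB cf Γ (Fm.rdiv C B)
  | ldiv_l (cf : Bool) (Δ : Ctx) (Γ : Meta) (A C D : Fm) :
      DervB cf Γ A → DervB cf (Δ.fill [Item.fm C]) D →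
      DervB cf (Δ.fill (Γ ++ [Item.fm (Fm.ldiv A C)])) D
  | ldiv_r (cf : Bool) (Γ : Meta) (A C : Fm) :
      DervB cf (Item.fm A :: Γ) C → DervB cf Γ (Fm.ldiv A C)
  | mul_l (cf : Bool) (Δ : Ctx) (A B D : Fm) :
      DervB cf (Δ.fill [Item.fm A, Item.fm B]) D →
      DervB cf (Δ.fill [Item.fm (Fm.mul A B)]) D
  | mul_r (cf : Bool) (Γ₁ Γ₂ : Meta) (A B : Fm) :
      DervB cf Γ₁ A → DervB cf Γ₂ B → DervB cf (Γ₁ ++ Γ₂) (Fm.mul A B)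
  | one_l (cf : Bool) (Δ : Ctx) (A : Fm) :
      DervB cf (Δ.fill []) A → DervB cf (Δ.fill [Item.fm Fm.one]) A
  | dia_l (cf : Bool) (Δ : Ctx) (A C : Fm) :
      DervB cf (Δ.fill [Item.br [Item.fm A]]) C →
      DervB cf (Δ.fill [Item.fm (Fm.dia A)]) C
  | dia_r (cf : Bool) (Θ : Meta) (A : Fm) :
      DervB cf Θ A → DervB cf [Item.br Θ] (Fm.dia A)
  | binv_l (cf : Bool) (Δ : Ctx) (A C : Fm) :
      DervB cf (Δ.fill [Item.fm A]) C →
      DervB cf (Δ.fill [Item.br [Item.fm (Fm.binv A)]]) C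
  | binv_r (cf : Bool) (Θ : Meta) (A : Fm) :
      DervB cf [Item.br Θ] A → DervB cf Θ (Fm.binv A)
  | bang_l (cf : Bool) (Δ : Ctx) (A B : Fm) :
      DervB cf (Δ.fill [Item.fm A]) B → DervB cf (Δ.fill [Item.fm (Fm.bang A)]) B
  | bang_r (cf : Bool) (Φ : List Fm) (A : Fm) :
      DervB cf (bangs Φ) A → DervB cf (bangs Φ) (Fm.bang A)
  | contr (cf : Bool) (Δ : Ctx) (Φ : List Fm) (Γ : Meta) (B : Fm) :
      Φ ≠ [] →
      DervB cf (Δ.fill (bangs Φ ++ [Item.br (bangs Φ ++ Γ)])) B →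
      DervB cf (Δ.fill (bangs Φ ++ Γ)) B
  | perm1 (cf : Bool) (Δ : Ctx) (A : Fm) (Γ : Meta) (B : Fm) :
      DervB cf (Δ.fill (Item.fm (Fm.bang A) :: Γ)) B →
      DervB cf (Δ.fill (Γ ++ [Item.fm (Fm.bang A)])) B
  | perm2 (cf : Bool) (Δ : Ctx) (A : Fm) (Γ : Meta) (B : Fm) :
      DervB cf (Δ.fill (Γ ++ [Item.fm (Fm.bang A)])) B →
      DervB cf (Δ.fill (Item.fm (Fm.bang A) :: Γ)) B
  | cut (Δ : Ctx) (Θ : Meta) (A C : Fm) :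
      DervB true Θ A → DervB true (Δ.fill [Item.fm A]) C →
      DervB true (Δ.fill Θ) C

/-! ## Bracket-free formulae and the calculi `!L1` and `!wL1` -/

/-- Bracket-free formulae (language of `!L1` / `!wL1`). -/
inductive Fm0 : Type
  | var : ℕ → Fm0
  | one : Fm0
  | ldiv : Fm0 → Fm0 → Fm0
  | rdiv : Fm0 → Fm0 → Fm0
  | mul : Fm0 → Fm0 → Fm0
  | bang : Fm0 → Fm0

/-- Derivability in `!L1` / `!wL1`.  The first boolean allows the weakening
rule (`DervL true` is `!wL1`, `DervL false` is `!L1`); the second boolean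
allows the rule (cut). -/
inductive DervL : Bool → Bool → List Fm0 → Fm0 → Prop
  | id (w cf : Bool) (A : Fm0) : DervL w cf [A] A
  | one_r (w cf : Bool) : DervL w cf [] Fm0.one
  | rdiv_l (w cf : Bool) (Γ Δ₁ Δ₂ : List Fm0) (B C D : Fm0) :
      DervL w cf Γ B → DervL w cf (Δ₁ ++ C :: Δ₂) D →
      DervL w cf (Δ₁ ++ Fm0.rdiv C B :: (Γ ++ Δ₂)) D
  | rdiv_r (w cf : Bool) (Γ : List Fm0) (B C : Fm0) :
      DervL w cf (Γ ++ [B]) C → DervL w cf Γ (Fm0.rdiv C B)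
  | ldiv_l (w cf : Bool) (Γ Δ₁ Δ₂ : List Fm0) (A C D : Fm0) :
      DervL w cf Γ A → DervL w cf (Δ₁ ++ C :: Δ₂) D →
      DervL w cf (Δ₁ ++ Γ ++ Fm0.ldiv A C :: Δ₂) D
  | ldiv_r (w cf : Bool) (Γ : List Fm0) (A C : Fm0) :
      DervL w cf (A :: Γ) C → DervL w cf Γ (Fm0.ldiv A C)
  | mul_l (w cf : Bool) (Δ₁ Δ₂ : List Fm0) (A B D : Fm0) :
      DervL w cf (Δ₁ ++ A :: B :: Δ₂) D → DervL w cf (Δ₁ ++ Fm0.mul A B :: Δ₂) D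
  | mul_r (w cf : Bool) (Γ₁ Γ₂ : List Fm0) (A B : Fm0) :
      DervL w cf Γ₁ A → DervL w cf Γ₂ B → DervL w cf (Γ₁ ++ Γ₂) (Fm0.mul A B)
  | one_l (w cf : Bool) (Δ₁ Δ₂ : List Fm0) (A : Fm0) :
      DervL w cf (Δ₁ ++ Δ₂) A → DervL w cf (Δ₁ ++ Fm0.one :: Δ₂) A
  | bang_l (w cf : Bool) (Δ₁ Δ₂ : List Fm0) (A B : Fm0) :
      DervL w cf (Δ₁ ++ A :: Δ₂) B → DervL w cf (Δ₁ ++ Fm0.bang A :: Δ₂) B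
  | bang_r (w cf : Bool) (Φ : List Fm0) (A : Fm0) :
      DervL w cf (Φ.map Fm0.bang) A → DervL w cf (Φ.map Fm0.bang) (Fm0.bang A)
  | perm1 (w cf : Bool) (Δ₁ Γ Δ₂ : List Fm0) (A B : Fm0) :
      DervL w cf (Δ₁ ++ Fm0.bang A :: (Γ ++ Δ₂)) B →
      DervL w cf (Δ₁ ++ Γ ++ Fm0.bang A :: Δ₂) B
  | perm2 (w cf : Bool) (Δ₁ Γ Δ₂ : List Fm0) (A B : Fm0) :
      DervL w cf (Δ₁ ++ Γ ++ Fm0.bang A :: Δ₂) B →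
      DervL w cf (Δ₁ ++ Fm0.bang A :: (Γ ++ Δ₂)) B
  | contr (w cf : Bool) (Δ₁ Δ₂ : List Fm0) (A B : Fm0) :
      DervL w cf (Δ₁ ++ Fm0.bang A :: Fm0.bang A :: Δ₂) B →
      DervL w cf (Δ₁ ++ Fm0.bang A :: Δ₂) B
  | weak (cf : Bool) (Δ₁ Δ₂ : List Fm0) (A B : Fm0) :
      DervL true cf (Δ₁ ++ Δ₂) B → DervL true cf (Δ₁ ++ Fm0.bang A :: Δ₂) B
  | cut (w : Bool) (Θ Δ₁ Δ₂ : List Fm0) (A C : Fm0) :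
      DervL w true Θ A → DervL w true (Δ₁ ++ A :: Δ₂) C →
      DervL w true (Δ₁ ++ Θ ++ Δ₂) C

/-! ## The Lambek calculus with unit `L1` and theories `L1 + T` -/

/-- Formulae of `L1` (no `!`, no bracket modalities). -/
inductive Fm1 : Type
  | var : ℕ → Fm1
  | one : Fm1
  | ldiv : Fm1 → Fm1 → Fm1
  | rdiv : Fm1 → Fm1 → Fm1
  | mul : Fm1 → Fm1 → Fm1

/-- Sequents of `L1`. -/
abbrev Seq1 := List Fm1 × Fm1

/-- Derivability in `L1 + T` (sequents of `T` are extra axioms). -/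
inductive DervT (T : Set Seq1) : List Fm1 → Fm1 → Prop
  | id (A : Fm1) : DervT T [A] A
  | one_r : DervT T [] Fm1.one
  | ax (Γ : List Fm1) (A : Fm1) : (Γ, A) ∈ T → DervT T Γ A
  | rdiv_l (Γ Δ₁ Δ₂ : List Fm1) (B C D : Fm1) :
      DervT T Γ B → DervT T (Δ₁ ++ C :: Δ₂) D →
      DervT T (Δ₁ ++ Fm1.rdiv C B :: (Γ ++ Δ₂)) D
  | rdiv_r (Γ : List Fm1) (B C : Fm1) :
      DervT T (Γ ++ [B]) C → DervT T Γ (Fm1.rdiv C B)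
  | ldiv_l (Γ Δ₁ Δ₂ : List Fm1) (A C D : Fm1) :
      DervT T Γ A → DervT T (Δ₁ ++ C :: Δ₂) D →
      DervT T (Δ₁ ++ Γ ++ Fm1.ldiv A C :: Δ₂) D
  | ldiv_r (Γ : List Fm1) (A C : Fm1) :
      DervT T (A :: Γ) C → DervT T Γ (Fm1.ldiv A C)
  | mul_l (Δ₁ Δ₂ : List Fm1) (A B D : Fm1) :
      DervT T (Δ₁ ++ A :: B :: Δ₂) D → DervT T (Δ₁ ++ Fm1.mul A B :: Δ₂) D
  | mul_r (Γ₁ Γ₂ : List Fm1) (A B : Fm1) :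
      DervT T Γ₁ A → DervT T Γ₂ B → DervT T (Γ₁ ++ Γ₂) (Fm1.mul A B)
  | one_l (Δ₁ Δ₂ : List Fm1) (A : Fm1) :
      DervT T (Δ₁ ++ Δ₂) A → DervT T (Δ₁ ++ Fm1.one :: Δ₂) A
  | cut (Θ Δ₁ Δ₂ : List Fm1) (A C : Fm1) :
      DervT T Θ A → DervT T (Δ₁ ++ A :: Δ₂) C →
      DervT T (Δ₁ ++ Θ ++ Δ₂) C

/-- Derivability in `L1 + T` where every application of (cut) must have a
sequent from `T` as one of its premises. -/
inductive DervTr (T : Set Seq1) : List Fm1 → Fm1 → Prop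
  | id (A : Fm1) : DervTr T [A] A
  | one_r : DervTr T [] Fm1.one
  | ax (Γ : List Fm1) (A : Fm1) : (Γ, A) ∈ T → DervTr T Γ A
  | rdiv_l (Γ Δ₁ Δ₂ : List Fm1) (B C D : Fm1) :
      DervTr T Γ B → DervTr T (Δ₁ ++ C :: Δ₂) D →
      DervTr T (Δ₁ ++ Fm1.rdiv C B :: (Γ ++ Δ₂)) D
  | rdiv_r (Γ : List Fm1) (B C : Fm1) :
      DervTr T (Γ ++ [B]) C → DervTr T Γ (Fm1.rdiv C B)
  | ldiv_l (Γ Δ₁ Δ₂ : List Fm1) (A C D : Fm1) :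
      DervTr T Γ A → DervTr T (Δ₁ ++ C :: Δ₂) D →
      DervTr T (Δ₁ ++ Γ ++ Fm1.ldiv A C :: Δ₂) D
  | ldiv_r (Γ : List Fm1) (A C : Fm1) :
      DervTr T (A :: Γ) C → DervTr T Γ (Fm1.ldiv A C)
  | mul_l (Δ₁ Δ₂ : List Fm1) (A B D : Fm1) :
      DervTr T (Δ₁ ++ A :: B :: Δ₂) D → DervTr T (Δ₁ ++ Fm1.mul A B :: Δ₂) D
  | mul_r (Γ₁ Γ₂ : List Fm1) (A B : Fm1) :
      DervTr T Γ₁ A → DervTr T Γ₂ B → DervTr T (Γ₁ ++ Γ₂) (Fm1.mul A B)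
  | one_l (Δ₁ Δ₂ : List Fm1) (A : Fm1) :
      DervTr T (Δ₁ ++ Δ₂) A → DervTr T (Δ₁ ++ Fm1.one :: Δ₂) A
  | cut (Θ Δ₁ Δ₂ : List Fm1) (A C : Fm1) :
      (Θ, A) ∈ T ∨ (Δ₁ ++ A :: Δ₂, C) ∈ T →
      DervTr T Θ A → DervTr T (Δ₁ ++ A :: Δ₂) C →
      DervTr T (Δ₁ ++ Θ ++ Δ₂) C

/-- Derivability in `L1 + T` by a derivation all of whose sequents satisfy
the predicate `Good`. -/
inductive DervTgood (T : Set Seq1) (Good : List Fm1 → Fm1 → Prop) : List Fm1 → Fm1 → Prop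
  | id (A : Fm1) : Good [A] A → DervTgood T Good [A] A
  | one_r : Good [] Fm1.one → DervTgood T Good [] Fm1.one
  | ax (Γ : List Fm1) (A : Fm1) : (Γ, A) ∈ T → Good Γ A → DervTgood T Good Γ A
  | rdiv_l (Γ Δ₁ Δ₂ : List Fm1) (B C D : Fm1) :
      DervTgood T Good Γ B → DervTgood T Good (Δ₁ ++ C :: Δ₂) D →
      Good (Δ₁ ++ Fm1.rdiv C B :: (Γ ++ Δ₂)) D →
      DervTgood T Good (Δ₁ ++ Fm1.rdiv C B :: (Γ ++ Δ₂)) D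
  | rdiv_r (Γ : List Fm1) (B C : Fm1) :
      DervTgood T Good (Γ ++ [B]) C → Good Γ (Fm1.rdiv C B) →
      DervTgood T Good Γ (Fm1.rdiv C B)
  | ldiv_l (Γ Δ₁ Δ₂ : List Fm1) (A C D : Fm1) :
      DervTgood T Good Γ A → DervTgood T Good (Δ₁ ++ C :: Δ₂) D →
      Good (Δ₁ ++ Γ ++ Fm1.ldiv A C :: Δ₂) D →
      DervTgood T Good (Δ₁ ++ Γ ++ Fm1.ldiv A C :: Δ₂) D
  | ldiv_r (Γ : List Fm1) (A C : Fm1) :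
      DervTgood T Good (A :: Γ) C → Good Γ (Fm1.ldiv A C) →
      DervTgood T Good Γ (Fm1.ldiv A C)
  | mul_l (Δ₁ Δ₂ : List Fm1) (A B D : Fm1) :
      DervTgood T Good (Δ₁ ++ A :: B :: Δ₂) D →
      Good (Δ₁ ++ Fm1.mul A B :: Δ₂) D →
      DervTgood T Good (Δ₁ ++ Fm1.mul A B :: Δ₂) D
  | mul_r (Γ₁ Γ₂ : List Fm1) (A B : Fm1) :
      DervTgood T Good Γ₁ A → DervTgood T Good Γ₂ B →
      Good (Γ₁ ++ Γ₂) (Fm1.mul A B) →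
      DervTgood T Good (Γ₁ ++ Γ₂) (Fm1.mul A B)
  | one_l (Δ₁ Δ₂ : List Fm1) (A : Fm1) :
      DervTgood T Good (Δ₁ ++ Δ₂) A → Good (Δ₁ ++ Fm1.one :: Δ₂) A →
      DervTgood T Good (Δ₁ ++ Fm1.one :: Δ₂) A
  | cut (Θ Δ₁ Δ₂ : List Fm1) (A C : Fm1) :
      DervTgood T Good Θ A → DervTgood T Good (Δ₁ ++ A :: Δ₂) C →
      Good (Δ₁ ++ Θ ++ Δ₂) C →
      DervTgood T Good (Δ₁ ++ Θ ++ Δ₂) C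

/-- The formula is built from primitive types using only the product `·`. -/
def ProdOnly : Fm1 → Prop
  | Fm1.var _ => True
  | Fm1.mul A B => ProdOnly A ∧ ProdOnly B
  | _ => False

/-- A sequent contains no occurrences of `\`, `/`, `1`. -/
def ProdOnlySeq (Γ : List Fm1) (A : Fm1) : Prop :=
  (∀ F ∈ Γ, ProdOnly F) ∧ ProdOnly A

/-! ## The bracket-forgetting projection -/

/-- BFP on formulae: delete all `⟨⟩` and `[]⁻¹`. -/
def fmBFP : Fm → Fm0
  | Fm.var n => Fm0.var n
  | Fm.one => Fm0.one
  | Fm.ldiv A B => Fm0.ldiv (fmBFP A) (fmBFP B)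
  | Fm.rdiv A B => Fm0.rdiv (fmBFP A) (fmBFP B)
  | Fm.mul A B => Fm0.mul (fmBFP A) (fmBFP B)
  | Fm.dia A => fmBFP A
  | Fm.binv A => fmBFP A
  | Fm.bang A => Fm0.bang (fmBFP A)

mutual
  /-- BFP on items. -/
  def itemBFP : Item → List Fm0
    | Item.fm A => [fmBFP A]
    | Item.br Γ => metaBFP Γ
  /-- BFP on meta-formulae: delete all brackets. -/
  def metaBFP : List Item → List Fm0
    | [] => []
    | i :: Γ => itemBFP i ++ metaBFP Γ
end

/-! ## Generative grammars (semi-Thue systems) -/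

/-- A generative grammar (semi-Thue system) over symbols coded by `ℕ`. -/
structure Grammar where
  nonterminals : Finset ℕ
  terminals : Finset ℕ
  disj : Disjoint nonterminals terminals
  start : ℕ
  start_mem : start ∈ nonterminals
  prods : Finset (List ℕ × List ℕ)
  prods_wf : ∀ p ∈ prods,
    (∀ c ∈ p.1, c ∈ nonterminals ∪ terminals) ∧
    (∀ c ∈ p.2, c ∈ nonterminals ∪ terminals)

/-- One rewriting step `η α θ ⇒_G η β θ`. -/
def Grammar.Step (G : Grammar) (x y : List ℕ) : Prop :=
  ∃ p ∈ G.prods, ∃ η θ : List ℕ, x = η ++ p.1 ++ θ ∧ y = η ++ p.2 ++ θ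

/-- `⇒*_G`: reflexive-transitive closure of `⇒_G`. -/
def Grammar.Derives (G : Grammar) : List ℕ → List ℕ → Prop :=
  Relation.ReflTransGen G.Step

/-- All productions of `G` have nonempty left- and right-hand sides. -/
def Grammar.NonemptySides (G : Grammar) : Prop :=
  ∀ p ∈ G.prods, p.1 ≠ [] ∧ p.2 ≠ []

/-! ### Encoding grammars into formulae -/

/-- `u₁ · … · u_k` as an `Fm`-formula (`1` for the empty word). -/
def wordFm : List ℕ → Fm
  | [] => Fm.one
  | [a] => Fm.var a
  | a :: b :: rest => Fm.mul (Fm.var a) (wordFm (b :: rest))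

/-- `u₁ · … · u_k` as an `Fm0`-formula. -/
def wordFm0 : List ℕ → Fm0
  | [] => Fm0.one
  | [a] => Fm0.var a
  | a :: b :: rest => Fm0.mul (Fm0.var a) (wordFm0 (b :: rest))

/-- `u₁ · … · u_k` as an `Fm1`-formula. -/
def wordFm1 : List ℕ → Fm1
  | [] => Fm1.one
  | [a] => Fm1.var a
  | a :: b :: rest => Fm1.mul (Fm1.var a) (wordFm1 (b :: rest))

/-- The formula `(u₁·…·u_k) / (v₁·…·v_m)` for a production `u ⇒ v`, in `Fm`. -/
def prodFm (p : List ℕ × List ℕ) : Fm := Fm.rdiv (wordFm p.1) (wordFm p.2)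

/-- The formula `(u₁·…·u_k) / (v₁·…·v_m)` for a production `u ⇒ v`, in `Fm0`. -/
def prodFm0 (p : List ℕ × List ℕ) : Fm0 := Fm0.rdiv (wordFm0 p.1) (wordFm0 p.2)

/-- `Γ_G = !B₁, …, !Bₙ` (bracket-free). -/
noncomputable def GammaG (G : Grammar) : List Fm0 :=
  G.prods.toList.map (fun p => Fm0.bang (prodFm0 p))

/-- `Φ_G = !(1 / !B₁), …, !(1 / !Bₙ)` (bracket-free). -/
noncomputable def PhiG (G : Grammar) : List Fm0 :=
  G.prods.toList.map (fun p => Fm0.bang (Fm0.rdiv Fm0.one (Fm0.bang (prodFm0 p))))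

/-- `Γ̃_G = ![]⁻¹B₁, …, ![]⁻¹Bₙ`. -/
noncomputable def GammaTG (G : Grammar) : Meta :=
  G.prods.toList.map (fun p => Item.fm (Fm.bang (Fm.binv (prodFm p))))

/-- `Φ̃_G = !(1 / ![]⁻¹B₁), …, !(1 / ![]⁻¹Bₙ)`. -/
noncomputable def PhiTG (G : Grammar) : Meta :=
  G.prods.toList.map
    (fun p => Item.fm (Fm.bang (Fm.rdiv Fm.one (Fm.bang (Fm.binv (prodFm p))))))

/-- The theory `T_G = { v₁, …, v_m → u₁·…·u_k : (u ⇒ v) ∈ P }`. -/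
def TG (G : Grammar) : Set Seq1 :=
  { q | ∃ p ∈ G.prods, q = (p.2.map Fm1.var, wordFm1 p.1) }

/-! ## Effective encodings of sequents into `ℕ` -/

/-- An effective injective code of `!bL1`-formulae. -/
def encFm : Fm → ℕ
  | Fm.var n => Nat.pair 0 n
  | Fm.one => Nat.pair 1 0
  | Fm.ldiv A B => Nat.pair 2 (Nat.pair (encFm A) (encFm B))
  | Fm.rdiv A B => Nat.pair 3 (Nat.pair (encFm A) (encFm B))
  | Fm.mul A B => Nat.pair 4 (Nat.pair (encFm A) (encFm B))
  | Fm.dia A => Nat.pair 5 (encFm A)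
  | Fm.binv A => Nat.pair 6 (encFm A)
  | Fm.bang A => Nat.pair 7 (encFm A)

mutual
  /-- An effective injective code of items. -/
  def encItem : Item → ℕ
    | Item.fm A => Nat.pair 0 (encFm A)
    | Item.br Γ => Nat.pair 1 (encMeta Γ)
  /-- An effective injective code of meta-formulae. -/
  def encMeta : List Item → ℕ
    | [] => 0
    | i :: Γ => Nat.pair (encItem i) (encMeta Γ) + 1
end

/-- An effective injective code of `!bL1`-sequents. -/
def encSeqB (Γ : Meta) (A : Fm) : ℕ := Nat.pair (encMeta Γ) (encFm A)

/-- An effective injective code of bracket-free formulae. -/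
def encFm0 : Fm0 → ℕ
  | Fm0.var n => Nat.pair 0 n
  | Fm0.one => Nat.pair 1 0
  | Fm0.ldiv A B => Nat.pair 2 (Nat.pair (encFm0 A) (encFm0 B))
  | Fm0.rdiv A B => Nat.pair 3 (Nat.pair (encFm0 A) (encFm0 B))
  | Fm0.mul A B => Nat.pair 4 (Nat.pair (encFm0 A) (encFm0 B))
  | Fm0.bang A => Nat.pair 5 (encFm0 A)

/-- An effective injective code of `!L1`/`!wL1`-sequents. -/
def encSeq0 (Γ : List Fm0) (A : Fm0) : ℕ :=
  Nat.pair ((Γ.map encFm0).foldr (fun a r => Nat.pair a r + 1) 0) (encFm0 A)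

/-! ## Sizes -/

/-- Size (number of symbols) of a formula. -/
def fmSize : Fm → ℕ
  | Fm.var _ => 1
  | Fm.one => 1
  | Fm.ldiv A B => fmSize A + fmSize B + 1
  | Fm.rdiv A B => fmSize A + fmSize B + 1
  | Fm.mul A B => fmSize A + fmSize B + 1
  | Fm.dia A => fmSize A + 1
  | Fm.binv A => fmSize A + 1
  | Fm.bang A => fmSize A + 1

mutual
  /-- Size of an item. -/
  def itemSize : Item → ℕ
    | Item.fm A => fmSize A
    | Item.br Γ => metaSize Γ + 1
  /-- Size of a meta-formula. -/
  def metaSize : List Item → ℕ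
    | [] => 0
    | i :: Γ => itemSize i + metaSize Γ
end

/-! ## Polarity and the bracket non-negative condition -/

/-- `cleanFm pol A`: the formula `A`, all of whose subformula occurrences have
their polarity in the sequent tracked starting from `pol` (`true` = positive),
contains no `[]⁻¹`-subformula at positive polarity and no `⟨⟩`-subformula at
negative polarity. -/
def cleanFm : Bool → Fm → Prop
  | _, Fm.var _ => True
  | _, Fm.one => True
  | pol, Fm.ldiv A B => cleanFm (!pol) A ∧ cleanFm pol B
  | pol, Fm.rdiv B A => cleanFm pol B ∧ cleanFm (!pol) A
  | pol, Fm.mul A B => cleanFm pol A ∧ cleanFm pol B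
  | pol, Fm.dia A => pol = true ∧ cleanFm pol A
  | pol, Fm.binv A => pol = false ∧ cleanFm pol A
  | pol, Fm.bang A => cleanFm pol A

/-- `bnnFm pol A`: every negative occurrence of a `!`-subformula of `A`
(where `A` itself occurs at polarity `pol` in the sequent) includes no
positive occurrence of `[]⁻¹C` and no negative occurrence of `⟨⟩C`. -/
def bnnFm : Bool → Fm → Prop
  | _, Fm.var _ => True
  | _, Fm.one => True
  | pol, Fm.ldiv A B => bnnFm (!pol) A ∧ bnnFm pol B
  | pol, Fm.rdiv B A => bnnFm pol B ∧ bnnFm (!pol) A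
  | pol, Fm.mul A B => bnnFm pol A ∧ bnnFm pol B
  | pol, Fm.dia A => bnnFm pol A
  | pol, Fm.binv A => bnnFm pol A
  | pol, Fm.bang A => (pol = false → cleanFm false A) ∧ bnnFm pol A

mutual
  /-- The bracket non-negative condition for an item of an antecedent. -/
  def bnnItem : Item → Prop
    | Item.fm A => bnnFm false A
    | Item.br Γ => bnnMeta Γ
  /-- The bracket non-negative condition for an antecedent. -/
  def bnnMeta : List Item → Prop
    | [] => True
    | i :: Γ => bnnItem i ∧ bnnMeta Γ
end

/-- The sequent `Γ → C` obeys the bracket non-negative condition. -/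
def bnnSeq (Γ : Meta) (C : Fm) : Prop := bnnMeta Γ ∧ bnnFm true C

/-! ## The formulation of `!bL1` with the generalized permutation rule -/

/-- `interleave Δ₀ [(A₁,Δ₁), …, (A_k,Δ_k)] = Δ₀, !A₁, Δ₁, …, !A_k, Δ_k`. -/
def interleave : Meta → List (Fm × Meta) → Meta
  | Δ₀, [] => Δ₀
  | Δ₀, (A, Δ) :: rest => Δ₀ ++ Item.fm (Fm.bang A) :: interleave Δ rest

/-- Derivations in the formulation of `!bL1` in which `(perm₁)`, `(perm₂)` are
replaced by the generalized permutation rule `(perm)*`.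
`NDervP cf b n Γ C` means: there is a derivation of `Γ → C` in which
(cut) is allowed only if `cf = true`, no two applications of `(perm)*` are
consecutive, `b` records whether the last rule applied is `(perm)*`, and the
derivation has exactly `n` rule applications (axiom instances included). -/
inductive NDervP : Bool → Bool → ℕ → Meta → Fm → Prop
  | id (cf : Bool) (A : Fm) : NDervP cf false 1 [Item.fm A] A
  | one_r (cf : Bool) : NDervP cf false 1 [] Fm.one
  | rdiv_l (cf b₁ b₂ : Bool) (n₁ n₂ : ℕ) (Δ : Ctx) (Γ : Meta) (B C D : Fm) :
      NDervP cf b₁ n₁ Γ B → NDervP cf b₂ n₂ (Δ.fill [Item.fm C]) D →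
      NDervP cf false (n₁ + n₂ + 1) (Δ.fill (Item.fm (Fm.rdiv C B) :: Γ)) D
  | rdiv_r (cf b : Bool) (n : ℕ) (Γ : Meta) (B C : Fm) :
      NDervP cf b n (Γ ++ [Item.fm B]) C → NDervP cf false (n + 1) Γ (Fm.rdiv C B)
  | ldiv_l (cf b₁ b₂ : Bool) (n₁ n₂ : ℕ) (Δ : Ctx) (Γ : Meta) (A C D : Fm) :
      NDervP cf b₁ n₁ Γ A → NDervP cf b₂ n₂ (Δ.fill [Item.fm C]) D →
      NDervP cf false (n₁ + n₂ + 1) (Δ.fill (Γ ++ [Item.fm (Fm.ldiv A C)])) D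
  | ldiv_r (cf b : Bool) (n : ℕ) (Γ : Meta) (A C : Fm) :
      NDervP cf b n (Item.fm A :: Γ) C → NDervP cf false (n + 1) Γ (Fm.ldiv A C)
  | mul_l (cf b : Bool) (n : ℕ) (Δ : Ctx) (A B D : Fm) :
      NDervP cf b n (Δ.fill [Item.fm A, Item.fm B]) D →
      NDervP cf false (n + 1) (Δ.fill [Item.fm (Fm.mul A B)]) D
  | mul_r (cf b₁ b₂ : Bool) (n₁ n₂ : ℕ) (Γ₁ Γ₂ : Meta) (A B : Fm) :
      NDervP cf b₁ n₁ Γ₁ A → NDervP cf b₂ n₂ Γ₂ B →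
      NDervP cf false (n₁ + n₂ + 1) (Γ₁ ++ Γ₂) (Fm.mul A B)
  | one_l (cf b : Bool) (n : ℕ) (Δ : Ctx) (A : Fm) :
      NDervP cf b n (Δ.fill []) A → NDervP cf false (n + 1) (Δ.fill [Item.fm Fm.one]) A
  | dia_l (cf b : Bool) (n : ℕ) (Δ : Ctx) (A C : Fm) :
      NDervP cf b n (Δ.fill [Item.br [Item.fm A]]) C →
      NDervP cf false (n + 1) (Δ.fill [Item.fm (Fm.dia A)]) C
  | dia_r (cf b : Bool) (n : ℕ) (Θ : Meta) (A : Fm) :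
      NDervP cf b n Θ A → NDervP cf false (n + 1) [Item.br Θ] (Fm.dia A)
  | binv_l (cf b : Bool) (n : ℕ) (Δ : Ctx) (A C : Fm) :
      NDervP cf b n (Δ.fill [Item.fm A]) C →
      NDervP cf false (n + 1) (Δ.fill [Item.br [Item.fm (Fm.binv A)]]) C
  | binv_r (cf b : Bool) (n : ℕ) (Θ : Meta) (A : Fm) :
      NDervP cf b n [Item.br Θ] A → NDervP cf false (n + 1) Θ (Fm.binv A)
  | bang_l (cf b : Bool) (n : ℕ) (Δ : Ctx) (A B : Fm) :
      NDervP cf b n (Δ.fill [Item.fm A]) B →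
      NDervP cf false (n + 1) (Δ.fill [Item.fm (Fm.bang A)]) B
  | bang_r (cf b : Bool) (n : ℕ) (Φ : List Fm) (A : Fm) :
      NDervP cf b n (bangs Φ) A → NDervP cf false (n + 1) (bangs Φ) (Fm.bang A)
  | contr (cf b : Bool) (n : ℕ) (Δ : Ctx) (Φ : List Fm) (Γ : Meta) (B : Fm) :
      Φ ≠ [] →
      NDervP cf b n (Δ.fill (bangs Φ ++ [Item.br (bangs Φ ++ Γ)])) B →
      NDervP cf false (n + 1) (Δ.fill (bangs Φ ++ Γ)) B
  | permStar (cf : Bool) (n : ℕ) (Δ : Ctx) (Δ₀ : Meta) (L L' : List (Fm × Meta)) (C : Fm) :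
      L.map Prod.snd = L'.map Prod.snd →
      (L.map Prod.fst).Perm (L'.map Prod.fst) →
      NDervP cf false n (Δ.fill (interleave Δ₀ L)) C →
      NDervP cf true (n + 1) (Δ.fill (interleave Δ₀ L')) C
  | cut (b₁ b₂ : Bool) (n₁ n₂ : ℕ) (Δ : Ctx) (Θ : Meta) (A C : Fm) :
      NDervP true b₁ n₁ Θ A → NDervP true b₂ n₂ (Δ.fill [Item.fm A]) C →
      NDervP true false (n₁ + n₂ + 1) (Δ.fill Θ) C

/-! ## Semi-Thue systems in `!L1` -/

section Rewriting

variable {α : Type*}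

/-- One rewriting step of the semi-Thue system with rules `P`. -/
def RewStep (P : List (List α × List α)) (x y : List α) : Prop :=
  ∃ p ∈ P, ∃ η θ : List α, x = η ++ p.1 ++ θ ∧ y = η ++ p.2 ++ θ

/-- Reachability in the semi-Thue system with rules `P`. -/
def Rew (P : List (List α × List α)) : List α → List α → Prop :=
  Relation.ReflTransGen (RewStep P)

theorem Rew.refl (P : List (List α × List α)) (x : List α) : Rew P x x :=
  Relation.ReflTransGen.refl

theorem Rew.trans {P : List (List α × List α)} {x y z : List α} (h₁ : Rew P x y)
    (h₂ : Rew P y z) : Rew P x z :=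
  Relation.ReflTransGen.trans h₁ h₂

theorem Rew.context {P : List (List α × List α)} {x y : List α} (h : Rew P x y)
    (l r : List α) : Rew P (l ++ x ++ r) (l ++ y ++ r) := by
  refine Relation.ReflTransGen.lift (fun z => l ++ z ++ r) ?_ _ _ h
  rintro _ _ ⟨p, hp, η, θ, rfl, rfl⟩
  exact ⟨p, hp, l ++ η, θ ++ r, by simp, by simp⟩

theorem Rew.append {P : List (List α × List α)} {x x' y y' : List α} (h₁ : Rew P x x')
    (h₂ : Rew P y y') : Rew P (x ++ y) (x' ++ y') := by
  have h := (h₁.context [] y).trans (by simpa using h₂.context x' [])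
  simpa using h

theorem Rew.of_mem {P : List (List α × List α)} {p : List α × List α} (hp : p ∈ P) :
    Rew P p.1 p.2 :=
  Relation.ReflTransGen.single ⟨p, hp, [], [], by simp, by simp⟩

/-- Interpretation of formulae as sets of words closed under reverse rewriting; the letter `a`
is named by the primitive type `e a`. -/
def interp (P : List (List α × List α)) (e : α → ℕ) : Fm0 → List α → Prop
  | Fm0.var n, w => ∀ a, e a = n → Rew P w [a]
  | Fm0.one, w => Rew P w []
  | Fm0.ldiv A C, w => ∀ x, interp P e A x → interp P e C (x ++ w)
  | Fm0.rdiv C B, w => ∀ x, interp P e B x → interp P e C (w ++ x)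
  | Fm0.mul A B, w => ∃ x y, interp P e A x ∧ interp P e B y ∧ Rew P w (x ++ y)
  | Fm0.bang A, w => interp P e A [] ∧ Rew P w []

/-- `w` splits into consecutive words interpreting the members of `Γ`. -/
def interpList (P : List (List α × List α)) (e : α → ℕ) : List Fm0 → List α → Prop
  | [], w => w = []
  | A :: Γ, w => ∃ x y, w = x ++ y ∧ interp P e A x ∧ interpList P e Γ y

variable {P : List (List α × List α)} {e : α → ℕ}

theorem interp.of_rew : ∀ {A : Fm0} {w w' : List α}, interp P e A w' → Rew P w w' →
    interp P e A w
  | Fm0.var _, _, _, h, hw => fun a ha => hw.trans (h a ha)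
  | Fm0.one, _, _, h, hw => hw.trans h
  | Fm0.ldiv _ _, _, _, h, hw => fun x hx => (h x hx).of_rew ((Rew.refl P x).append hw)
  | Fm0.rdiv _ _, _, _, h, hw => fun x hx => (h x hx).of_rew (hw.append (Rew.refl P x))
  | Fm0.mul _ _, _, _, ⟨x, y, hx, hy, h⟩, hw => ⟨x, y, hx, hy, hw.trans h⟩
  | Fm0.bang _, _, _, ⟨h, h'⟩, hw => ⟨h, hw.trans h'⟩

theorem interpList_append {Γ Δ : List Fm0} {w : List α} :
    interpList P e (Γ ++ Δ) w ↔
      ∃ x y, w = x ++ y ∧ interpList P e Γ x ∧ interpList P e Δ y := by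
  induction Γ generalizing w with
  | nil => simp [interpList]
  | cons A Γ ih =>
    simp only [List.cons_append, interpList, ih]
    constructor
    · rintro ⟨x, _, rfl, hx, y, z, rfl, hy, hz⟩
      exact ⟨x ++ y, z, by simp, ⟨x, y, rfl, hx, hy⟩, hz⟩
    · rintro ⟨_, z, rfl, ⟨x, y, rfl, hx, hy⟩, hz⟩
      exact ⟨x, y ++ z, by simp, hx, y, z, rfl, hy, hz⟩

theorem interpList_singleton {A : Fm0} {w : List α} :
    interpList P e [A] w ↔ interp P e A w := by
  simp [interpList]

theorem interpList_map_bang {Φ : List Fm0} {w : List α}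
    (h : interpList P e (Φ.map Fm0.bang) w) :
    Rew P w [] ∧ interpList P e (Φ.map Fm0.bang) [] := by
  induction Φ generalizing w with
  | nil => cases h; exact ⟨Rew.refl P _, rfl⟩
  | cons A Φ ih =>
    obtain ⟨x, y, rfl, ⟨hA, hx⟩, hy⟩ := h
    exact ⟨hx.append (ih hy).1, [], [], rfl, ⟨hA, Rew.refl P _⟩, (ih hy).2⟩

theorem DervL.sound {w cf : Bool} {Γ : List Fm0} {A : Fm0} (h : DervL w cf Γ A) :
    ∀ {x : List α}, interpList P e Γ x → interp P e A x := by
  induction h with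
  | id => exact fun h => interpList_singleton.1 h
  | one_r => rintro _ rfl; exact Rew.refl P _
  | rdiv_l w cf Γ Δ₁ Δ₂ B C D _ _ ih₁ ih₂ =>
    intro x h
    obtain ⟨x, _, rfl, hx, c, _, rfl, hc, h⟩ := interpList_append.1 h
    obtain ⟨g, y, rfl, hg, hy⟩ := interpList_append.1 h
    have := ih₂ (interpList_append.2 ⟨x, _, rfl, hx, c ++ g, y, rfl, hc _ (ih₁ hg), hy⟩)
    simpa using this
  | rdiv_r w cf Γ B C _ ih =>
    exact fun h y hy => ih (interpList_append.2 ⟨_, y, rfl, h, interpList_singleton.2 hy⟩)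
  | ldiv_l w cf Γ Δ₁ Δ₂ A C D _ _ ih₁ ih₂ =>
    intro x h
    obtain ⟨_, _, rfl, hΔ, c, y, rfl, hc, hy⟩ := interpList_append.1 h
    obtain ⟨x, g, rfl, hx, hg⟩ := interpList_append.1 hΔ
    have := ih₂ (interpList_append.2 ⟨x, _, rfl, hx, g ++ c, y, rfl, hc _ (ih₁ hg), hy⟩)
    simpa using this
  | ldiv_r w cf Γ A C _ ih => exact fun h y hy => ih ⟨y, _, rfl, hy, h⟩
  | mul_l w cf Δ₁ Δ₂ A B D _ ih =>
    intro x h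
    obtain ⟨x, _, rfl, hx, c, y, rfl, ⟨a, b, ha, hb, hc⟩, hy⟩ := interpList_append.1 h
    have := ih (interpList_append.2 ⟨x, _, rfl, hx, a, _, rfl, ha, b, y, rfl, hb, hy⟩)
    refine this.of_rew ?_
    simpa using hc.context x y
  | mul_r w cf Γ₁ Γ₂ A B _ _ ih₁ ih₂ =>
    intro x h
    obtain ⟨x, y, rfl, hx, hy⟩ := interpList_append.1 h
    exact ⟨x, y, ih₁ hx, ih₂ hy, Rew.refl P _⟩
  | one_l w cf Δ₁ Δ₂ A _ ih =>
    intro x h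
    obtain ⟨x, _, rfl, hx, c, y, rfl, hc, hy⟩ := interpList_append.1 h
    refine (ih (interpList_append.2 ⟨x, y, rfl, hx, hy⟩)).of_rew ?_
    simpa using Rew.context hc x y
  | bang_l w cf Δ₁ Δ₂ A B _ ih =>
    intro x h
    obtain ⟨x, _, rfl, hx, c, y, rfl, ⟨hA, hc⟩, hy⟩ := interpList_append.1 h
    exact ih (interpList_append.2 ⟨x, _, rfl, hx, c, y, rfl, hA.of_rew hc, hy⟩)
  | bang_r w cf Φ A _ ih =>
    intro x h
    exact ⟨ih (interpList_map_bang h).2, (interpList_map_bang h).1⟩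
  | perm1 w cf Δ₁ Γ Δ₂ A B _ ih =>
    intro x h
    obtain ⟨_, _, rfl, hΔ, c, y, rfl, ⟨hA, hc⟩, hy⟩ := interpList_append.1 h
    obtain ⟨x, g, rfl, hx, hg⟩ := interpList_append.1 hΔ
    refine (ih (interpList_append.2 ⟨x, _, rfl, hx, [], _, rfl, ⟨hA, Rew.refl P _⟩,
      interpList_append.2 ⟨g, y, rfl, hg, hy⟩⟩)).of_rew ?_
    simpa using hc.context (x ++ g) y
  | perm2 w cf Δ₁ Γ Δ₂ A B _ ih =>
    intro x h
    obtain ⟨x, _, rfl, hx, c, _, rfl, ⟨hA, hc⟩, h⟩ := interpList_append.1 h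
    obtain ⟨g, y, rfl, hg, hy⟩ := interpList_append.1 h
    refine (ih (interpList_append.2 ⟨x ++ g, _, rfl, interpList_append.2 ⟨x, g, rfl, hx, hg⟩,
      [], y, rfl, ⟨hA, Rew.refl P _⟩, hy⟩)).of_rew ?_
    simpa using hc.context x (g ++ y)
  | contr w cf Δ₁ Δ₂ A B _ ih =>
    intro x h
    obtain ⟨x, _, rfl, hx, c, y, rfl, hc, hy⟩ := interpList_append.1 h
    exact ih (interpList_append.2 ⟨x, _, rfl, hx, c, y, rfl, hc, [], y, rfl,
      ⟨hc.1, Rew.refl P _⟩, hy⟩)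
  | weak cf Δ₁ Δ₂ A B _ ih =>
    intro x h
    obtain ⟨x, _, rfl, hx, c, y, rfl, hc, hy⟩ := interpList_append.1 h
    refine (ih (interpList_append.2 ⟨x, y, rfl, hx, hy⟩)).of_rew ?_
    simpa using hc.2.context x y
  | cut w Θ Δ₁ Δ₂ A C _ _ ih₁ ih₂ =>
    intro x h
    obtain ⟨_, y, rfl, h, hy⟩ := interpList_append.1 h
    obtain ⟨x, c, rfl, hx, hc⟩ := interpList_append.1 h
    have := ih₂ (interpList_append.2 ⟨x, _, rfl, hx, c, y, rfl, ih₁ hc, hy⟩)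
    simpa using this

theorem interp_wordFm0 (he : Function.Injective e) :
    ∀ {u w : List α}, interp P e (wordFm0 (u.map e)) w ↔ Rew P w u
  | [], _ => Iff.rfl
  | [a], w => ⟨fun h => h a rfl, fun h b hb => he hb ▸ h⟩
  | a :: b :: u, w => by
    have ih : ∀ {y}, interp P e (wordFm0 (e b :: u.map e)) y ↔ Rew P y (b :: u) :=
      fun {y} => interp_wordFm0 he (u := b :: u)
    constructor
    · rintro ⟨x, y, hx, hy, h⟩
      exact h.trans ((hx a rfl).append (ih.1 hy))
    · exact fun h => ⟨[a], b :: u, fun c hc => he hc ▸ Rew.refl P _, ih.2 (Rew.refl P _), h⟩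

theorem interpList_word {w : List α} (he : Function.Injective e) :
    interpList P e (w.map fun a => Fm0.var (e a)) w := by
  induction w with
  | nil => rfl
  | cons a w ih => exact ⟨[a], w, rfl, fun c hc => he hc ▸ Rew.refl P _, ih⟩

/-- The formula `v / u` performing the rewriting `u ⇒ v`. -/
def ruleFm (e : α → ℕ) (p : List α × List α) : Fm0 := prodFm0 (p.2.map e, p.1.map e)

/-- The rules of a semi-Thue system as an antecedent, each one with the formula erasing it. -/
def rulesFm (P : List (List α × List α)) (e : α → ℕ) : List Fm0 :=
  P.flatMap fun p => [Fm0.rdiv Fm0.one (Fm0.bang (ruleFm e p)), Fm0.bang (ruleFm e p)]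

theorem interpList_rulesFm {Q : List (List α × List α)} (he : Function.Injective e)
    (hQ : Q ⊆ P) : interpList P e (rulesFm Q e) [] := by
  induction Q with
  | nil => rfl
  | cons p Q ih =>
    have hp : interp P e (Fm0.bang (ruleFm e p)) [] :=
      ⟨fun x hx => (interp_wordFm0 he).2 (((interp_wordFm0 he).1 hx).trans
        (Rew.of_mem (hQ List.mem_cons_self))), Rew.refl P _⟩
    exact ⟨[], [], rfl, fun x hx => hx.2, [], [], rfl, hp,
      ih fun q hq => hQ (List.mem_cons_of_mem _ hq)⟩

theorem dervL_wordFm0 {w cf : Bool} :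
    ∀ u : List ℕ, DervL w cf (u.map Fm0.var) (wordFm0 u)
  | [] => DervL.one_r _ _
  | [_] => DervL.id _ _ _
  | a :: b :: u =>
    DervL.mul_r w cf [Fm0.var a] ((b :: u).map Fm0.var) _ _ (DervL.id _ _ _)
      (dervL_wordFm0 (b :: u))

theorem DervL.word_left {w cf : Bool} {Δ₂ : List Fm0} {C : Fm0} :
    ∀ (u : List ℕ) {Δ₁ : List Fm0}, DervL w cf (Δ₁ ++ (u.map Fm0.var ++ Δ₂)) C →
      DervL w cf (Δ₁ ++ wordFm0 u :: Δ₂) C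
  | [], _, h => DervL.one_l _ _ _ _ _ h
  | [_], _, h => h
  | a :: b :: u, Δ₁, h => by
    refine DervL.mul_l _ _ _ _ _ _ _ ?_
    have := word_left (b :: u) (Δ₁ := Δ₁ ++ [Fm0.var a]) (Δ₂ := Δ₂) (C := C) (w := w) (cf := cf)
      (by simpa using h)
    simpa using this

theorem DervL.apply_rule {w cf : Bool} {Δ₁ Δ₂ : List Fm0} {C : Fm0} {p : List α × List α}
    (h : DervL w cf (Δ₁ ++ (p.2.map (fun a => Fm0.var (e a)) ++ Δ₂)) C) :
    DervL w cf (Δ₁ ++ Fm0.bang (ruleFm e p) :: (p.1.map (fun a => Fm0.var (e a)) ++ Δ₂)) C := by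
  refine DervL.bang_l _ _ _ _ _ _ (DervL.rdiv_l _ _ _ _ _ _ _ _ ?_ (DervL.word_left _ ?_))
  · simpa [Function.comp_def] using dervL_wordFm0 (w := w) (cf := cf) (p.1.map e)
  · simpa [Function.comp_def] using h

theorem dervL_rulesFm_erase {w cf : Bool} {Δ : List Fm0} {C : Fm0} (h : DervL w cf Δ C) :
    DervL w cf (rulesFm P e ++ Δ) C := by
  induction P with
  | nil => exact h
  | cons p P ih =>
    exact DervL.rdiv_l w cf [Fm0.bang (ruleFm e p)] [] (rulesFm P e ++ Δ) _ _ _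
      (DervL.id _ _ _) (DervL.one_l w cf [] _ _ ih)

theorem dervL_of_rewStep {w cf : Bool} {x y : List α} {C : Fm0} (hxy : RewStep P x y)
    (h : DervL w cf (rulesFm P e ++ y.map fun a => Fm0.var (e a)) C) :
    DervL w cf (rulesFm P e ++ x.map fun a => Fm0.var (e a)) C := by
  obtain ⟨p, hp, η, θ, rfl, rfl⟩ := hxy
  obtain ⟨Φ, Ψ, hΦ⟩ : ∃ Φ Ψ, rulesFm P e = Φ ++ Fm0.bang (ruleFm e p) :: Ψ :=
    List.append_of_mem (List.mem_flatMap.2 ⟨p, hp, by simp⟩)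
  have h' : DervL w cf ((rulesFm P e ++ η.map fun a => Fm0.var (e a)) ++
      (p.2.map (fun a => Fm0.var (e a)) ++ θ.map fun a => Fm0.var (e a))) C := by
    simpa using h
  have h₁ := h'.apply_rule
  rw [hΦ] at h₁ ⊢
  have h₂ := DervL.perm2 w cf Φ (Fm0.bang (ruleFm e p) :: (Ψ ++ η.map fun a => Fm0.var (e a)))
    ((p.1 ++ θ).map fun a => Fm0.var (e a)) (ruleFm e p) C (by simpa using h₁)
  simpa using DervL.contr w cf Φ (Ψ ++ (η ++ p.1 ++ θ).map fun a => Fm0.var (e a))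
    (ruleFm e p) C (by simpa using h₂)

theorem dervL_rulesFm_iff {cf : Bool} (he : Function.Injective e) (x : List α) (a : α) :
    DervL false cf (rulesFm P e ++ x.map fun b => Fm0.var (e b)) (Fm0.var (e a)) ↔
      Rew P x [a] := by
  constructor
  · intro h
    exact h.sound (P := P) (e := e)
      (interpList_append.2 ⟨[], x, rfl, interpList_rulesFm he (List.Subset.refl P),
        interpList_word he⟩) a rfl
  · intro h
    induction h using Relation.ReflTransGen.head_induction_on with
    | refl => exact dervL_rulesFm_erase (DervL.id _ _ _)
    | head hs _ ih => exact dervL_of_rewStep hs ih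

end Rewriting

/-! ## An undecidable halting problem for a fixed Turing machine -/

section Halting

open Turing

theorem exists_partrec_dom_not_computable :
    ∃ f : ℕ →. ℕ, Nat.Partrec f ∧ ¬ ComputablePred fun n => (f n).Dom := by
  refine ⟨fun n => Nat.Partrec.Code.eval (Denumerable.ofNat _ n) 0, ?_, fun h => ?_⟩
  · exact Partrec.nat_iff.1
      (Nat.Partrec.Code.eval_part.comp (Computable.ofNat _) (Computable.const 0))
  · refine ComputablePred.halting_problem 0 ?_
    have := ComputablePred.computable_iff.1 h
    obtain ⟨g, hg, e⟩ := this
    refine ComputablePred.computable_iff.2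
      ⟨fun c => g (Encodable.encode c), hg.comp Computable.encode, ?_⟩
    funext c
    simpa using congrFun e (Encodable.encode c)

theorem exists_code_pow_two_dom_not_computable :
    ∃ c : ToPartrec.Code, ¬ ComputablePred fun k : ℕ => (c.eval [2 ^ k]).Dom := by
  obtain ⟨f, hf, hn⟩ := exists_partrec_dom_not_computable
  have hg : Nat.Partrec (fun m => (Nat.rfind fun k => Part.some (decide (2 ^ k = m))).bind f) := by
    refine Partrec.nat_iff.1 (Partrec.bind (Partrec.rfind ?_)
      ((Partrec.nat_iff.2 hf).comp Computable.snd).to₂)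
    have hpow : Primrec fun k : ℕ => 2 ^ k :=
      (Primrec.nat_rec₁ (f := fun _ r => 2 * r) 1
        (Primrec.nat_mul.comp (Primrec.const 2) Primrec.snd).to₂).of_eq fun k => by
          induction k with
          | zero => rfl
          | succ k ih => rw [pow_succ', ← ih]
    have h : PrimrecPred fun p : ℕ × ℕ => 2 ^ p.2 = p.1 :=
      Primrec.eq.comp (hpow.comp Primrec.snd) Primrec.fst
    exact (Primrec.to_comp (h.decide)).partrec
  obtain ⟨c, hc⟩ := ToPartrec.Code.exists_code (Nat.Partrec'.part_iff₁.2 (Partrec.nat_iff.2 hg))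
  refine ⟨c, fun h => hn ?_⟩
  convert h using 2 with k
  have := hc (2 ^ k ::ᵥ List.Vector.nil)
  simp only [List.Vector.head_cons] at this
  have e : (2 ^ k ::ᵥ List.Vector.nil).1 = [2 ^ k] := rfl
  rw [e] at this
  rw [this]
  have hr : (Nat.rfind fun j => Part.some (decide (2 ^ j = 2 ^ k))) = Part.some k := by
    refine Part.eq_some_iff.2 (Nat.mem_rfind.2 ⟨by simp, fun {m} hm => ?_⟩)
    simp only [Part.mem_some_iff, Bool.false_eq, decide_eq_false_iff_not]
    exact fun h => hm.ne (Nat.pow_right_injective le_rfl h)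
  rw [hr]
  erw [Part.bind_some]
  rfl

open PartrecToTM2 in
theorem trNat_two_pow (k : ℕ) : trNat (2 ^ k) = List.replicate k Γ'.bit0 ++ [Γ'.bit1] := by
  have hp : ((PosNum.bit0^[k] PosNum.one : PosNum) : ℕ) = 2 ^ k := by
    induction k with
    | zero => rfl
    | succ k ih => rw [Function.iterate_succ_apply', PosNum.cast_bit0, ih, pow_succ, mul_two]
  have h : ((2 ^ k : ℕ) : Num) = Num.pos (PosNum.bit0^[k] PosNum.one) := by
    rw [← hp, ← Num.cast_pos, Num.of_to_nat]
  rw [trNat, h]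
  change trPosNum _ = _
  clear h hp
  induction k with
  | zero => rfl
  | succ k ih => rw [Function.iterate_succ_apply', trPosNum, ih]; rfl

open PartrecToTM2 in
/-- The track contents of a tape cell holding `x` on the main stack and nothing elsewhere. -/
def mainStackSymbol (x : Γ') : K' → Option Γ' :=
  Function.update (fun _ => none) K'.main (some x)

open PartrecToTM2 in
theorem trInit_trList_two_pow (k : ℕ) :
    TM2to1.trInit (Γ := fun _ => Γ') K'.main (trList [2 ^ k]) =
      (true, mainStackSymbol Γ'.cons) :: (false, mainStackSymbol Γ'.bit1) ::
        List.replicate k (false, mainStackSymbol Γ'.bit0) := by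
  have h : (trList [2 ^ k]).reverse = Γ'.cons :: Γ'.bit1 :: List.replicate k Γ'.bit0 := by
    simp [trList, trNat_two_pow]
  unfold TM2to1.trInit
  rw [h]
  exact congrArg (fun l => (true, mainStackSymbol Γ'.cons) :: (false, mainStackSymbol Γ'.bit1) :: l)
    (List.map_replicate (f := fun a => (false, mainStackSymbol a)))

theorem exists_TM0_not_computable :
    ∃ (Γ Λ : Type) (_ : Finite Γ) (_ : Inhabited Γ) (_ : Inhabited Λ)
      (M : TM0.Machine Γ Λ) (S : Finset Λ) (a b c : Γ),
      TM0.Supports M S ∧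
      ¬ ComputablePred fun k : ℕ => (TM0.eval M (a :: b :: List.replicate k c)).Dom := by
  classical
  obtain ⟨c, hc⟩ := exists_code_pow_two_dom_not_computable
  let i : Inhabited PartrecToTM2.Λ' := ⟨PartrecToTM2.trNormal c PartrecToTM2.Cont'.halt⟩
  have : Finite PartrecToTM2.K' :=
    Finite.of_injective (β := Fin 4)
      (fun k => match k with | .main => 0 | .rev => 1 | .aux => 2 | .stack => 3)
      (by rintro (_ | _) (_ | _) h <;> first | rfl | cases h)
  have := Fintype.ofFinite PartrecToTM2.K'
  have hs0 := TM1to0.tr_supports _ (TM2to1.tr_supports PartrecToTM2.tr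
    (PartrecToTM2.tr_supports c PartrecToTM2.Cont'.halt))
  refine ⟨_, _, inferInstance, inferInstance, inferInstance, _, _,
    (true, mainStackSymbol .cons),
    (false, mainStackSymbol .bit1),
    (false, mainStackSymbol .bit0), hs0, fun h => hc ?_⟩
  convert h using 2 with k
  have h₀ := TM1to0.tr_eval (TM2to1.tr PartrecToTM2.tr)
    (TM2to1.trInit PartrecToTM2.K'.main (PartrecToTM2.trList [2 ^ k]))
  have h₁ := TM2to1.tr_eval_dom PartrecToTM2.tr PartrecToTM2.K'.main
    (PartrecToTM2.trList [2 ^ k])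
  have h₂ := PartrecToTM2.tr_eval c [2 ^ k]
  have hi : TM2.init PartrecToTM2.K'.main (PartrecToTM2.trList [2 ^ k]) =
      PartrecToTM2.init c [2 ^ k] := by
    simp only [TM2.init, PartrecToTM2.init]
    congr 1
    funext x; cases x <;> rfl
  have h₃ : (TM2.eval PartrecToTM2.tr PartrecToTM2.K'.main (PartrecToTM2.trList [2 ^ k])).Dom ↔
      (c.eval [2 ^ k]).Dom := by
    unfold TM2.eval
    rw [hi]
    exact iff_of_eq (congrArg Part.Dom h₂)
  rw [trInit_trList_two_pow] at h₀ h₁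
  exact (h₃.symm.trans h₁.symm).trans (iff_of_eq (congrArg Part.Dom h₀)).symm

end Halting

/-! ## Simulating a Turing machine by a semi-Thue system -/

section TuringMachine

open Turing

/-- Letters for words describing configurations of a Turing machine with states `S` and tape
alphabet `Γ`: end markers, two letters used after halting, states and tape symbols. -/
inductive Letter (S Γ : Type) : Type
  | left : Letter S Γ
  | right : Letter S Γ
  | halted : Letter S Γ
  | done : Letter S Γ
  | state : S → Letter S Γ
  | cell : Γ → Letter S Γ

instance {S Γ : Type} [Finite S] [Finite Γ] : Finite (Letter S Γ) :=
  Finite.of_surjective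
    (fun x : Fin 4 ⊕ S ⊕ Γ => match x with
      | .inl 0 => Letter.left
      | .inl 1 => Letter.right
      | .inl 2 => Letter.halted
      | .inl 3 => Letter.done
      | .inr (.inl q) => Letter.state q
      | .inr (.inr a) => Letter.cell a)
    (by
      rintro (_ | _ | _ | _ | q | a)
      exacts [⟨.inl 0, rfl⟩, ⟨.inl 1, rfl⟩, ⟨.inl 2, rfl⟩, ⟨.inl 3, rfl⟩, ⟨.inr (.inl q), rfl⟩,
        ⟨.inr (.inr a), rfl⟩])

open Letter

variable {Γ Λ : Type} {S : Finset Λ}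

/-- The word describing the state `q`, the reversed tape `l` left of the head, and the tape `r`
from the head on. -/
def cfgWord (l : List Γ) (q : S) (r : List Γ) : List (Letter S Γ) :=
  left :: (l.reverse.map cell ++ state q :: (r.map cell ++ [right]))

theorem append_state_cons_inj {A B X Y : List (Letter S Γ)} {q q' : S}
    (hA : ∀ p, state p ∉ A) (hB : ∀ p, state p ∉ B)
    (h : X ++ state q' :: Y = A ++ state q :: B) : X = A ∧ q' = q ∧ Y = B := by
  induction X generalizing A with
  | nil =>
    cases A with
    | nil => simpa using h
    | cons a A =>
      cases (List.cons.inj h).1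
      exact absurd List.mem_cons_self (hA q')
  | cons x X ih =>
    cases A with
    | nil =>
      obtain ⟨-, rfl⟩ := List.cons.inj h
      exact absurd (by simp) (hB q')
    | cons a A =>
      obtain ⟨rfl, h'⟩ := List.cons.inj h
      obtain ⟨rfl, h''⟩ := ih (fun p hp => hA p (List.mem_cons_of_mem _ hp)) h'
      exact ⟨rfl, h''⟩

theorem exists_of_cell_cons_eq {Y : List (Letter S Γ)} {r : List Γ} {a : Γ}
    (h : cell a :: Y = r.map cell ++ [right]) :
    ∃ r', r = a :: r' ∧ Y = r'.map cell ++ [right] := by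
  cases r with
  | nil => simp at h
  | cons b r =>
    simp only [List.map_cons, List.cons_append, List.cons.injEq, Letter.cell.injEq] at h
    exact ⟨r, by rw [h.1], h.2⟩

theorem eq_cfgWord {X Y : List (Letter S Γ)} {l r : List Γ} {q q' : S}
    (h : X ++ state q' :: Y = cfgWord l q r) :
    X = left :: l.reverse.map cell ∧ q' = q ∧ Y = r.map cell ++ [right] :=
  append_state_cons_inj (by simp) (by simp) h

theorem halted_notMem_cfgWord {l r : List Γ} {q : S} : halted ∉ cfgWord l q r := by
  simp [cfgWord]

variable [Inhabited Γ]

theorem listBlank_mk_singleton_default : ListBlank.mk [(default : Γ)] = ListBlank.mk [] :=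
  (ListBlank.cons_mk default []).symm.trans (ListBlank.cons_head_tail (ListBlank.mk []))

/-- The configuration described by `cfgWord l q r`. -/
def listCfg (l : List Γ) (q : Λ) (r : List Γ) : TM0.Cfg Γ Λ :=
  ⟨q, Tape.mk' (ListBlank.mk l) (ListBlank.mk r)⟩

theorem listCfg_nil_right (l : List Γ) (q : Λ) : listCfg l q [default] = listCfg l q [] := by
  rw [listCfg, listBlank_mk_singleton_default, listCfg]

theorem listCfg_nil_left (q : Λ) (r : List Γ) : listCfg [default] q r = listCfg [] q r := by
  rw [listCfg, listBlank_mk_singleton_default, listCfg]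

variable [Inhabited Λ]

/-- The rewriting rules simulating the machine `M` on the states `S`. A halting configuration is
rewritten to `halted`, which then consumes the tape. -/
inductive TMRule (M : TM0.Machine Γ Λ) (S : Finset Λ) :
    List (Letter S Γ) → List (Letter S Γ) → Prop
  | write (q q' : S) (a b : Γ) : M q a = some (q'.1, TM0.Stmt.write b) →
      TMRule M S [state q, cell a] [state q', cell b]
  | moveRight (q q' : S) (a : Γ) : M q a = some (q'.1, TM0.Stmt.move Dir.right) →
      TMRule M S [state q, cell a] [cell a, state q']
  | moveLeft (q q' : S) (a c : Γ) : M q a = some (q'.1, TM0.Stmt.move Dir.left) →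
      TMRule M S [cell c, state q, cell a] [state q', cell c, cell a]
  | padRight (q : S) : TMRule M S [state q, right] [state q, cell default, right]
  | padLeft (q : S) : TMRule M S [left, state q] [left, cell default, state q]
  | halt (q : S) (a : Γ) : M q a = none → TMRule M S [state q, cell a] [halted]
  | eatLeft (c : Γ) : TMRule M S [cell c, halted] [halted]
  | eatRight (c : Γ) : TMRule M S [halted, cell c] [halted]
  | done : TMRule M S [left, halted, right] [done]

theorem exists_list_tmRule [Finite Γ] (M : TM0.Machine Γ Λ) (S : Finset Λ) :
    ∃ P : List (List (Letter S Γ) × List (Letter S Γ)), ∀ u v, (u, v) ∈ P ↔ TMRule M S u v := by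
  have hf : {p : List (Letter S Γ) × List (Letter S Γ) | TMRule M S p.1 p.2}.Finite := by
    refine ((List.finite_length_le (Letter S Γ) 3).prod
      (List.finite_length_le (Letter S Γ) 3)).subset ?_
    rintro ⟨u, v⟩ h
    have h : TMRule M S u v := h
    cases h <;> simp
  exact ⟨hf.toFinset.toList, fun u v => by simp⟩

variable {M : TM0.Machine Γ Λ}

theorem step_listCfg_none {l r : List Γ} {q : Λ} {a : Γ} (h : M q a = none) :
    TM0.step M (listCfg l q (a :: r)) = none := by
  simp [TM0.step, listCfg, h]

theorem step_listCfg_write {l r : List Γ} {q q' : Λ} {a b : Γ}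
    (h : M q a = some (q', TM0.Stmt.write b)) :
    TM0.step M (listCfg l q (a :: r)) = some (listCfg l q' (b :: r)) := by
  simp [TM0.step, listCfg, h, ← ListBlank.cons_mk]

theorem step_listCfg_moveRight {l r : List Γ} {q q' : Λ} {a : Γ}
    (h : M q a = some (q', TM0.Stmt.move Dir.right)) :
    TM0.step M (listCfg l q (a :: r)) = some (listCfg (a :: l) q' r) := by
  simp [TM0.step, listCfg, h, ← ListBlank.cons_mk]

theorem step_listCfg_moveLeft {l r : List Γ} {q q' : Λ} {a c : Γ}
    (h : M q a = some (q', TM0.Stmt.move Dir.left)) :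
    TM0.step M (listCfg (c :: l) q (a :: r)) = some (listCfg l q' (c :: a :: r)) := by
  simp [TM0.step, listCfg, h, ← ListBlank.cons_mk]

theorem eval_dom_of_step_none {σ : Type*} {f : σ → Option σ} {c : σ} (h : f c = none) :
    (StateTransition.eval f c).Dom :=
  Part.dom_iff_mem.2 ⟨c, StateTransition.mem_eval.2 ⟨Relation.ReflTransGen.refl, h⟩⟩

theorem eval_dom_of_step_some {σ : Type*} {f : σ → Option σ} {c c' : σ} (h : f c = some c')
    (hc : (StateTransition.eval f c').Dom) : (StateTransition.eval f c).Dom := by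
  rwa [StateTransition.reaches_eval (Relation.ReflTransGen.single h)]

theorem eval_dom_of_rew {P : List (List (Letter S Γ) × List (Letter S Γ))}
    (hP : ∀ u v, (u, v) ∈ P → TMRule M S u v) {w : List (Letter S Γ)} (hw : Rew P w [done]) :
    ∀ (l : List Γ) (q : S) (r : List Γ), w = cfgWord l q r →
      (StateTransition.eval (TM0.step M) (listCfg l q r)).Dom := by
  induction hw using Relation.ReflTransGen.head_induction_on with
  | refl => intro l q r h; simp [cfgWord] at h
  | head hs _ ih =>
    intro l q r h
    obtain ⟨⟨u, v⟩, hp, η, θ, rfl, rfl⟩ := hs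
    dsimp only at h ih
    cases hP u v hp with
    | write q₀ q' a b hM =>
      obtain ⟨rfl, rfl, hr⟩ := eq_cfgWord (X := η) (Y := cell a :: θ) (by simpa using h)
      obtain ⟨r, rfl, rfl⟩ := exists_of_cell_cons_eq hr
      exact eval_dom_of_step_some (step_listCfg_write hM) (ih _ q' _ (by simp [cfgWord]))
    | moveRight q₀ q' a hM =>
      obtain ⟨rfl, rfl, hr⟩ := eq_cfgWord (X := η) (Y := cell a :: θ) (by simpa using h)
      obtain ⟨r, rfl, rfl⟩ := exists_of_cell_cons_eq hr
      exact eval_dom_of_step_some (step_listCfg_moveRight hM) (ih _ q' _ (by simp [cfgWord]))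
    | moveLeft q₀ q' a c hM =>
      obtain ⟨hl, rfl, hr⟩ := eq_cfgWord (X := η ++ [cell c]) (Y := cell a :: θ) (by simpa using h)
      obtain ⟨r, rfl, rfl⟩ := exists_of_cell_cons_eq hr
      cases l with
      | nil =>
        have := List.append_inj_right' (s₁ := η) (s₂ := []) hl rfl
        simp at this
      | cons d l =>
        rw [List.reverse_cons, List.map_append, ← List.cons_append] at hl
        obtain ⟨rfl, hc⟩ := List.append_inj' hl rfl
        simp only [List.map_cons, List.map_nil, List.cons.injEq, Letter.cell.injEq, and_true] at hc
        subst hc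
        exact eval_dom_of_step_some (step_listCfg_moveLeft hM) (ih _ q' _ (by simp [cfgWord]))
    | padRight q₀ =>
      obtain ⟨rfl, rfl, hr⟩ := eq_cfgWord (X := η) (Y := right :: θ) (by simpa using h)
      cases r with
      | nil =>
        obtain rfl : θ = [] := by simpa using hr
        rw [← listCfg_nil_right]
        exact ih _ q₀ _ (by simp [cfgWord])
      | cons b r => simp at hr
    | padLeft q₀ =>
      obtain ⟨hl, rfl, rfl⟩ := eq_cfgWord (X := η ++ [left]) (Y := θ) (by simpa using h)
      cases l with
      | nil =>
        obtain rfl : η = [] := by simpa using hl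
        rw [← listCfg_nil_left]
        exact ih _ q₀ _ (by simp [cfgWord])
      | cons d l =>
        rw [List.reverse_cons, List.map_append, ← List.cons_append] at hl
        obtain ⟨rfl, hc⟩ := List.append_inj' hl rfl
        simp at hc
    | halt q₀ a hM =>
      obtain ⟨rfl, rfl, hr⟩ := eq_cfgWord (X := η) (Y := cell a :: θ) (by simpa using h)
      obtain ⟨r, rfl, rfl⟩ := exists_of_cell_cons_eq hr
      exact eval_dom_of_step_none (step_listCfg_none hM)
    | eatLeft c => exact absurd (h ▸ by simp) (halted_notMem_cfgWord (l := l) (q := q) (r := r))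
    | eatRight c => exact absurd (h ▸ by simp) (halted_notMem_cfgWord (l := l) (q := q) (r := r))
    | done => exact absurd (h ▸ by simp) (halted_notMem_cfgWord (l := l) (q := q) (r := r))

section Completeness

variable {P : List (List (Letter S Γ) × List (Letter S Γ))}

theorem rew_of_tmRule (hP : ∀ u v, TMRule M S u v → (u, v) ∈ P) {x y u v : List (Letter S Γ)}
    (h : TMRule M S u v) (η θ : List (Letter S Γ)) (hx : x = η ++ u ++ θ)
    (hy : y = η ++ v ++ θ) : Rew P x y := by
  subst hx hy
  exact (Rew.of_mem (hP u v h)).context η θ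

theorem rew_eat (hP : ∀ u v, TMRule M S u v → (u, v) ∈ P) (l r : List Γ) :
    Rew P (left :: (l.reverse.map cell ++ halted :: (r.map cell ++ [right]))) [done] := by
  induction r with
  | nil =>
    induction l with
    | nil => exact rew_of_tmRule hP TMRule.done [] [] (by simp) (by simp)
    | cons c l ih =>
      exact (rew_of_tmRule hP (TMRule.eatLeft c) (left :: l.reverse.map cell) [right]
        (by simp) (by simp)).trans ih
  | cons c r ih =>
    exact (rew_of_tmRule hP (TMRule.eatRight c) (left :: l.reverse.map cell)
      (r.map cell ++ [right]) (by simp) (by simp)).trans ih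

theorem rew_padRight (hP : ∀ u v, TMRule M S u v → (u, v) ∈ P) (l r : List Γ) (q : S) :
    ∃ a r', Rew P (cfgWord l q r) (cfgWord l q (a :: r')) ∧
      listCfg l q.1 r = listCfg l q.1 (a :: r') := by
  cases r with
  | nil =>
    exact ⟨default, [], rew_of_tmRule hP (TMRule.padRight q) (left :: l.reverse.map cell) []
      (by simp [cfgWord]) (by simp [cfgWord]), (listCfg_nil_right _ _).symm⟩
  | cons a r => exact ⟨a, r, Rew.refl _ _, rfl⟩

theorem rew_padLeft (hP : ∀ u v, TMRule M S u v → (u, v) ∈ P) (l r : List Γ) (q : S) :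
    ∃ c l', Rew P (cfgWord l q r) (cfgWord (c :: l') q r) ∧
      listCfg l q.1 r = listCfg (c :: l') q.1 r := by
  cases l with
  | nil =>
    exact ⟨default, [], rew_of_tmRule hP (TMRule.padLeft q) [] (r.map cell ++ [right])
      (by simp [cfgWord]) (by simp [cfgWord]), (listCfg_nil_left _ _).symm⟩
  | cons c l => exact ⟨c, l, Rew.refl _ _, rfl⟩

theorem rew_of_step (hS : TM0.Supports M S) (hP : ∀ u v, TMRule M S u v → (u, v) ∈ P)
    (l r : List Γ) (q : S) :
    match TM0.step M (listCfg l q.1 r) with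
    | none => Rew P (cfgWord l q r) [done]
    | some c => ∃ (l' : List Γ) (q' : S) (r' : List Γ), c = listCfg l' q'.1 r' ∧
        Rew P (cfgWord l q r) (cfgWord l' q' r') := by
  obtain ⟨a, r, h₁, e₁⟩ := rew_padRight hP l r q
  rw [e₁]
  rcases hM : M q a with _ | ⟨q', s⟩
  · rw [step_listCfg_none hM]
    exact h₁.trans ((rew_of_tmRule hP (TMRule.halt q a hM) (left :: l.reverse.map cell)
      (r.map cell ++ [right]) (by simp [cfgWord]) rfl).trans (by simpa using rew_eat hP l r))
  · lift q' to S using hS.2 hM q.2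
    rcases s with ⟨_ | _⟩ | b
    · obtain ⟨c, l, h₂, e₂⟩ := rew_padLeft hP l (a :: r) q
      rw [e₂, step_listCfg_moveLeft hM]
      exact ⟨_, q', _, rfl, h₁.trans (h₂.trans (rew_of_tmRule hP (TMRule.moveLeft q q' a c hM)
        (left :: l.reverse.map cell) (r.map cell ++ [right]) (by simp [cfgWord])
        (by simp [cfgWord])))⟩
    · rw [step_listCfg_moveRight hM]
      exact ⟨_, q', _, rfl, h₁.trans (rew_of_tmRule hP (TMRule.moveRight q q' a hM)
        (left :: l.reverse.map cell) (r.map cell ++ [right]) (by simp [cfgWord])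
        (by simp [cfgWord]))⟩
    · rw [step_listCfg_write hM]
      exact ⟨_, q', _, rfl, h₁.trans (rew_of_tmRule hP (TMRule.write q q' a b hM)
        (left :: l.reverse.map cell) (r.map cell ++ [right]) (by simp [cfgWord])
        (by simp [cfgWord]))⟩

theorem rew_of_eval_dom (hS : TM0.Supports M S) (hP : ∀ u v, TMRule M S u v → (u, v) ∈ P)
    (l r : List Γ) (q : S) (h : (StateTransition.eval (TM0.step M) (listCfg l q.1 r)).Dom) :
    Rew P (cfgWord l q r) [done] := by
  obtain ⟨b, hb⟩ := Part.dom_iff_mem.1 h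
  obtain ⟨hr, hn⟩ := StateTransition.mem_eval.1 hb
  generalize hc : listCfg l q.1 r = c at hr
  clear h hb
  induction hr using Relation.ReflTransGen.head_induction_on generalizing l q r with
  | refl =>
    have := rew_of_step hS hP l r q
    rwa [hc, hn] at this
  | head hs _ ih =>
    have := rew_of_step hS hP l r q
    rw [hc, Option.mem_def.1 hs] at this
    obtain ⟨l', q', r', e, h⟩ := this
    exact h.trans (ih l' r' q' e.symm)

end Completeness

theorem exists_rew_iff_eval_dom [Finite Γ] (hS : TM0.Supports M S) :
    ∃ P : List (List (Letter S Γ) × List (Letter S Γ)), ∀ r : List Γ,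
      Rew P (cfgWord [] ⟨default, hS.1⟩ r) [done] ↔ (TM0.eval M r).Dom := by
  obtain ⟨P, hP⟩ := exists_list_tmRule M S
  exact ⟨P, fun r => ⟨fun h => eval_dom_of_rew (fun u v => (hP u v).1) h _ _ _ rfl,
    fun h => rew_of_eval_dom hS (fun u v => (hP u v).2) _ _ _ h⟩⟩

end TuringMachine

/-! ## Codes of sequents -/

theorem encFm0_injective : Function.Injective encFm0 := by
  intro A
  induction A with
  | var n => intro B h; cases B <;> simp_all [encFm0, Nat.pair_eq_pair]
  | one => intro B h; cases B <;> simp_all [encFm0, Nat.pair_eq_pair]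
  | ldiv A₁ A₂ h₁ h₂ =>
    intro B h
    cases B <;> simp only [encFm0, Nat.pair_eq_pair] at h <;> try omega
    exact congrArg₂ _ (h₁ h.2.1) (h₂ h.2.2)
  | rdiv A₁ A₂ h₁ h₂ =>
    intro B h
    cases B <;> simp only [encFm0, Nat.pair_eq_pair] at h <;> try omega
    exact congrArg₂ _ (h₁ h.2.1) (h₂ h.2.2)
  | mul A₁ A₂ h₁ h₂ =>
    intro B h
    cases B <;> simp only [encFm0, Nat.pair_eq_pair] at h <;> try omega
    exact congrArg₂ _ (h₁ h.2.1) (h₂ h.2.2)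
  | bang A₁ h₁ =>
    intro B h
    cases B <;> simp only [encFm0, Nat.pair_eq_pair] at h <;> try omega
    exact congrArg _ (h₁ h.2)

theorem foldr_pair_succ_injective :
    Function.Injective fun l : List ℕ => l.foldr (fun a r => Nat.pair a r + 1) 0 := by
  intro l
  induction l with
  | nil => intro m h; cases m <;> simp_all
  | cons a l ih =>
    intro m h
    cases m with
    | nil => simp at h
    | cons b m =>
      obtain ⟨rfl, h'⟩ := Nat.pair_eq_pair.1 (Nat.succ.inj h)
      rw [ih h']

theorem encSeq0_inj {Γ Δ : List Fm0} {A B : Fm0} :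
    encSeq0 Γ A = encSeq0 Δ B ↔ Γ = Δ ∧ A = B := by
  refine ⟨fun h => ?_, by rintro ⟨rfl, rfl⟩; rfl⟩
  obtain ⟨h₁, h₂⟩ := Nat.pair_eq_pair.1 h
  exact ⟨encFm0_injective.list_map (foldr_pair_succ_injective h₁), encFm0_injective h₂⟩

theorem primrec_encSeq0_append_replicate (Γ Δ : List Fm0) (B A : Fm0) :
    Primrec fun k : ℕ => encSeq0 (Γ ++ (List.replicate k B ++ Δ)) A := by
  simp only [encSeq0, List.map_append, List.foldr_append, List.map_replicate]
  refine Primrec₂.natPair.comp ?_ (Primrec.const _)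
  induction Γ with
  | nil =>
    refine (Primrec.nat_rec₁ (f := fun _ r => Nat.pair (encFm0 B) r + 1)
      ((Δ.map encFm0).foldr (fun a r => Nat.pair a r + 1) 0)
      (Primrec.succ.comp (Primrec₂.natPair.comp (Primrec.const _) Primrec.snd)).to₂).of_eq
      fun k => ?_
    induction k with
    | zero => rfl
    | succ k ih => simpa [List.replicate_succ] using ih
  | cons C Γ ih => exact Primrec.succ.comp (Primrec₂.natPair.comp (Primrec.const _) ih)

/-- The derivability problem for `!L1` is undecidable:
the set of codes of derivable sequents (under the effective injective coding
`encSeq0`) is not computable. -/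
theorem bangL_undecidable :
    ¬ ComputablePred (fun n : ℕ =>
      ∃ Γ : List Fm0, ∃ A : Fm0, encSeq0 Γ A = n ∧ DervL false true Γ A) := by
  intro h
  obtain ⟨Γ, Λ, _, _, _, M, S, a, b, c, hS, hM⟩ := exists_TM0_not_computable
  obtain ⟨P, hP⟩ := exists_rew_iff_eval_dom hS
  obtain ⟨e, he⟩ := exists_injective_nat (Letter S Γ)
  refine hM ?_
  let var : Letter S Γ → Fm0 := fun x => Fm0.var (e x)
  have hc := primrec_encSeq0_append_replicate
    (rulesFm P e ++ [var .left, var (.state ⟨default, hS.1⟩), var (.cell a), var (.cell b)])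
    [var .right] (var (.cell c)) (var .done)
  obtain ⟨g, hg, eg⟩ := ComputablePred.computable_iff.1 h
  refine ComputablePred.computable_iff.2 ⟨_, hg.comp hc.to_comp, ?_⟩
  funext k
  rw [← congrFun eg, ← hP, ← dervL_rulesFm_iff (cf := true) he]
  simp [encSeq0_inj, cfgWord, var]

end Lambek
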